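/- Let A be a commutative ring. The set ℋ_n(W(A)) is closed under the operation ⋆_T, and the cancellation laws hold in ℋ_n(W(A)): if M ⋆_T N = M' ⋆_T N then M = M', and if M ⋆_T N = M ⋆_T N' then N = N'. Moreover, if A is a field, then ℋ_n(W(A)) with the operation ⋆_T and the identity matrix as unit is a loop: left and right multiplications by any element are bijections of ℋ_n(W(A)). -/

import Mathlib

noncomputable section

namespace MRT

/-- `T_a(x) = Σ_{k ≥ 0} V^k([a_k]·x)`.  The `n`-th component of the infinite sum is the `n`-th
component of the partial sum `Σ_{k ≤ n} V^k([a_k]·x)`, which is independent of further terms. -/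
def Tmap {p : ℕ} [Fact p.Prime] {A : Type} [CommRing A] (a x : WittVector p A) :
    WittVector p A :=
  WittVector.mk p fun n =>
    (∑ i ∈ Finset.range (n + 1),
        (fun y : WittVector p A => WittVector.verschiebung y)^[i]
          (WittVector.teichmuller p (a.coeff i) * x)).coeff n

/-- Membership in `ℋ_n(W(A))`: upper triangular matrices of Witt vectors whose diagonal
entries have `0`-th component a non-zero-divisor. -/
def IsH {p : ℕ} [Fact p.Prime] {A : Type} [CommRing A] {n : ℕ}
    (M : Matrix (Fin n) (Fin n) (WittVector p A)) : Prop :=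
  (∀ i j : Fin n, j < i → M i j = 0) ∧ ∀ i : Fin n, (M i i).coeff 0 ∈ nonZeroDivisors A

/-- The `T`-multiplication `M ⋆_T N`, with `(i,j)` entry `Σ_r T_{m_{ir}}(n_{rj})`. -/
def starT {p : ℕ} [Fact p.Prime] {A : Type} [CommRing A] {n : ℕ}
    (M N : Matrix (Fin n) (Fin n) (WittVector p A)) : Matrix (Fin n) (Fin n) (WittVector p A) :=
  fun i j => ∑ r, Tmap (M i r) (N r j)

section Aux

open WittVector Function

variable {p : ℕ} [Fact p.Prime] {A : Type} [CommRing A]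

/-- Adding an element of the `n`-th step of the `V`-filtration. -/
lemma coeff_add_iterate (y t : WittVector p A) (n : ℕ) :
    (y + verschiebung^[n] t).coeff n = y.coeff n + t.coeff 0 := by
  have h1 : tail n y = verschiebung^[n] ((tail n y).shift n) := by
    apply eq_iterate_verschiebung
    intro i hi
    simp only [WittVector.tail, WittVector.select, coeff_mk]
    rw [if_neg (by omega)]
  have h2 : y + verschiebung^[n] t
      = init n y + verschiebung^[n] ((tail n y).shift n + t) := by
    rw [iterate_map_add, ← h1, ← add_assoc, init_add_tail]
  have h3 : ((tail n y).shift n).coeff 0 = y.coeff n := by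
    rw [shift_coeff]
    simp [WittVector.tail, WittVector.select]
  have h4 : ∀ i, n ≤ i → (init n y).coeff i = 0 := by
    intro i hi
    simp only [WittVector.init, WittVector.select, coeff_mk]
    rw [if_neg (by omega)]
  have h5 : (verschiebung^[n] ((tail n y).shift n + t)).coeff n
      = ((tail n y).shift n + t).coeff 0 := by
    simpa using iterate_verschiebung_coeff ((tail n y).shift n + t) n 0
  rw [h2, coeff_add_of_disjoint, h4 n le_rfl, h5, add_coeff_zero, h3, zero_add]
  intro i
  rcases lt_or_ge i n with hi | hi
  · right; exact iterate_verschiebung_coeff_eq_zero _ hi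
  · left; exact h4 i hi

lemma Tmap_coeff (a x : WittVector p A) (n : ℕ) :
    (Tmap a x).coeff n = (∑ i ∈ Finset.range (n + 1),
      verschiebung^[i] (teichmuller p (a.coeff i) * x)).coeff n := rfl

lemma coeff_zero_iter_frob (a : A) (n : ℕ) :
    (frobenius^[n] (teichmuller p a)).coeff 0 = a ^ p ^ n := by
  have h0 : ∀ z : WittVector p A, ghostComponent 0 z = z.coeff 0 := by
    intro z; simp [ghostComponent_apply]
  have h : ∀ (n m : ℕ) (z : WittVector p A),
      ghostComponent m (frobenius^[n] z) = ghostComponent (m + n) z := by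
    intro n
    induction n with
    | zero => intro m z; simp
    | succ n ih =>
      intro m z
      rw [iterate_succ_apply, ih, ghostComponent_frobenius, add_assoc]
  rw [← h0, h, ghostComponent_teichmuller, zero_add]

lemma Tmap_diff_right (a x y : WittVector p A) (n : ℕ) (h : ∀ i < n, x.coeff i = y.coeff i) :
    (Tmap a x).coeff n - (Tmap a y).coeff n
      = (a.coeff 0) ^ p ^ n * (x.coeff n - y.coeff n) := by
  have hd := eq_iterate_verschiebung (le_coeff_eq_iff_le_sub_coeff_eq_zero.1 h)
  set t := (x - y).shift n
  have hx : x = y + verschiebung^[n] t := by rw [← hd]; ring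
  have hxn : x.coeff n = y.coeff n + t.coeff 0 := by rw [hx, coeff_add_iterate]
  have key : ∀ i, verschiebung^[i] (teichmuller p (a.coeff i) * verschiebung^[n] t)
      = verschiebung^[n] (verschiebung^[i]
          (t * frobenius^[n] (teichmuller p (a.coeff i)))) := by
    intro i
    rw [mul_comm, iterate_verschiebung_mul_left, ← iterate_add_apply, ← iterate_add_apply,
      add_comm]
  have hs : ∑ i ∈ Finset.range (n + 1), verschiebung^[i] (teichmuller p (a.coeff i) * x)
      = ∑ i ∈ Finset.range (n + 1), verschiebung^[i] (teichmuller p (a.coeff i) * y)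
        + verschiebung^[n] (∑ i ∈ Finset.range (n + 1), verschiebung^[i]
          (t * frobenius^[n] (teichmuller p (a.coeff i)))) := by
    have : ∀ s : Finset ℕ, ∀ f : ℕ → WittVector p A,
        verschiebung^[n] (∑ i ∈ s, f i) = ∑ i ∈ s, verschiebung^[n] (f i) := by
      intro s f
      classical
      induction s using Finset.induction with
      | empty => simp [iterate_map_zero]
      | insert a s ha ih => rw [Finset.sum_insert ha, Finset.sum_insert ha, iterate_map_add, ih]
    rw [this, ← Finset.sum_add_distrib]
    refine Finset.sum_congr rfl fun i _ => ?_
    rw [← key, ← iterate_map_add, ← mul_add, ← hx]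
  have h0 : (∑ i ∈ Finset.range (n + 1), verschiebung^[i]
      (t * frobenius^[n] (teichmuller p (a.coeff i)))).coeff 0
      = t.coeff 0 * (a.coeff 0) ^ p ^ n := by
    change constantCoeff _ = _
    rw [map_sum, Finset.sum_range_succ', Finset.sum_eq_zero]
    · rw [zero_add, iterate_zero, id, map_mul]
      change t.coeff 0 * (frobenius^[n] (teichmuller p (a.coeff 0))).coeff 0 = _
      rw [coeff_zero_iter_frob]
    · intro i _
      exact iterate_verschiebung_coeff_eq_zero _ (Nat.succ_pos i)
  rw [Tmap_coeff, Tmap_coeff, hs, coeff_add_iterate, h0, hxn]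
  ring

lemma Tmap_diff_left (a b x : WittVector p A) (n : ℕ) (h : ∀ i < n, a.coeff i = b.coeff i) :
    (Tmap a x).coeff n - (Tmap b x).coeff n
      = x.coeff 0 * (a.coeff n - b.coeff n) := by
  have : ∑ i ∈ Finset.range n, verschiebung^[i] (teichmuller p (a.coeff i) * x)
      = ∑ i ∈ Finset.range n, verschiebung^[i] (teichmuller p (b.coeff i) * x) :=
    Finset.sum_congr rfl fun i hi => by rw [h i (Finset.mem_range.1 hi)]
  rw [Tmap_coeff, Tmap_coeff, Finset.sum_range_succ, Finset.sum_range_succ, this,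
    coeff_add_iterate, coeff_add_iterate, mul_coeff_zero, mul_coeff_zero,
    teichmuller_coeff_zero, teichmuller_coeff_zero]
  ring

lemma Tmap_coeff_zero (a x : WittVector p A) :
    (Tmap a x).coeff 0 = a.coeff 0 * x.coeff 0 := by
  rw [Tmap_coeff]
  simp [mul_coeff_zero]

lemma iterate_zero' (n : ℕ) : verschiebung^[n] (0 : WittVector p A) = 0 :=
  iterate_map_zero _ _

lemma Tmap_zero_left (x : WittVector p A) : Tmap 0 x = 0 := by
  ext n
  rw [Tmap_coeff, Finset.sum_eq_zero]
  intro i _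
  rw [zero_coeff, teichmuller_zero, zero_mul, iterate_zero']

lemma Tmap_zero_right (a : WittVector p A) : Tmap a 0 = 0 := by
  ext n
  rw [Tmap_coeff, Finset.sum_eq_zero]
  intro i _
  rw [mul_zero, iterate_zero']

lemma Tmap_one_left (x : WittVector p A) : Tmap 1 x = x := by
  ext n
  rw [Tmap_coeff, Finset.sum_range_succ', Finset.sum_eq_zero]
  · simp
  · intro i _
    rw [one_coeff_eq_of_pos _ _ _ (Nat.succ_pos i), teichmuller_zero, zero_mul, iterate_zero']

lemma Tmap_one_right (a : WittVector p A) : Tmap a 1 = a := by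
  have h : ∀ m j : ℕ, (∑ i ∈ Finset.range m, verschiebung^[i] (teichmuller p (a.coeff i))).coeff j
      = if j < m then a.coeff j else 0 := by
    intro m
    induction m with
    | zero => intro j; simp
    | succ m ih =>
      intro j
      have hV : ∀ i, (verschiebung^[m] (teichmuller p (a.coeff m))).coeff i
          = if i = m then a.coeff m else 0 := by
        intro i
        rcases lt_or_ge i m with hi | hi
        · rw [iterate_verschiebung_coeff_eq_zero _ hi, if_neg hi.ne]
        · obtain ⟨k, rfl⟩ := Nat.exists_eq_add_of_le' hi
          rw [iterate_verschiebung_coeff]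
          rcases Nat.eq_zero_or_pos k with rfl | hk
          · simp
          · rw [teichmuller_coeff_pos _ _ _ hk, if_neg (by omega)]
      rw [Finset.sum_range_succ, coeff_add_of_disjoint, ih, hV]
      · rcases lt_trichotomy j m with hj | rfl | hj
        · rw [if_pos hj, if_neg hj.ne, if_pos (by omega), add_zero]
        · simp
        · rw [if_neg (by omega), if_neg (by omega), if_neg (by omega), add_zero]
      · intro i
        rw [ih, hV]
        by_cases hi : i < m
        · right; rw [if_neg hi.ne]
        · left; rw [if_neg hi]
  ext n
  rw [Tmap_coeff]
  simp only [mul_one]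
  rw [h, if_pos (Nat.lt_succ_self n)]

/-- Maps that are triangular on components with regular slopes are injective. -/
lemma tri_inj (F : WittVector p A → WittVector p A) (u : ℕ → A)
    (hu : ∀ n, u n ∈ nonZeroDivisors A)
    (hF : ∀ x y n, (∀ i < n, x.coeff i = y.coeff i) →
      (F x).coeff n - (F y).coeff n = u n * (x.coeff n - y.coeff n)) :
    Injective F := by
  intro x y hxy
  ext n
  induction n using Nat.strong_induction_on with
  | _ n ih =>
    have h := hF x y n ih
    rw [hxy, sub_self] at h
    exact sub_eq_zero.1 ((mul_right_mem_nonZeroDivisors_eq_zero_iff (hu n)).1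
      (by rw [mul_comm]; exact h.symm))

lemma tri_surj (F : WittVector p A → WittVector p A) (u : ℕ → A)
    (hu : ∀ n, IsUnit (u n))
    (hF : ∀ x y n, (∀ i < n, x.coeff i = y.coeff i) →
      (F x).coeff n - (F y).coeff n = u n * (x.coeff n - y.coeff n)) :
    Surjective F := by
  intro c
  choose v hv using fun n => (hu n).exists_right_inv
  let ind : ∀ n : ℕ, (∀ m : ℕ, m < n → A) → A := fun n ih =>
    v n * (c.coeff n - (F (WittVector.mk p fun i => if h : i < n then ih i h else 0)).coeff n)
  let z : ℕ → A := WellFoundedLT.fix ind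
  have hz : ∀ n, z n = v n * (c.coeff n -
      (F (WittVector.mk p fun i => if i < n then z i else 0)).coeff n) := by
    intro n
    have := WellFoundedLT.fix_eq ind n
    simpa only [ind, dite_eq_ite] using this
  refine ⟨WittVector.mk p z, ?_⟩
  ext n
  have h := hF (WittVector.mk p z) (WittVector.mk p fun i => if i < n then z i else 0) n
    (by intro i hi; simp [hi])
  simp only [coeff_mk, lt_irrefl, if_false, sub_zero] at h
  rw [hz n, ← mul_assoc, hv, one_mul] at h
  linear_combination h

end Aux

section Tri

variable {ι W : Type} [Fintype ι] [LinearOrder ι] [WellFoundedLT ι] [AddCommGroup W]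

lemma sys_split (f : ι → ι → W → W) (hf : ∀ i r, i < r → ∀ x, f i r x = 0) (x : ι → W) (i : ι) :
    ∑ r, f i r (x r) = (∑ r, if r < i then f i r (x r) else 0) + f i i (x i) := by
  have h1 : f i i (x i) = ∑ r, if r = i then f i r (x r) else 0 := by simp
  rw [h1, ← Finset.sum_add_distrib]
  refine Finset.sum_congr rfl fun r _ => ?_
  rcases lt_trichotomy r i with h | rfl | h
  · simp [h, h.ne]
  · simp
  · simp [hf i r h]

lemma sys_inj (f : ι → ι → W → W) (hf : ∀ i r, i < r → ∀ x, f i r x = 0)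
    (hi : ∀ i, Function.Injective (f i i)) (x y : ι → W) (i : ι)
    (h : ∀ k ≤ i, ∑ r, f k r (x r) = ∑ r, f k r (y r)) : x i = y i := by
  induction i using WellFoundedLT.induction with
  | _ i ih =>
    have h1 := h i le_rfl
    rw [sys_split f hf, sys_split f hf] at h1
    have h2 : (∑ r, if r < i then f i r (x r) else 0) = ∑ r, if r < i then f i r (y r) else 0 := by
      refine Finset.sum_congr rfl fun r _ => ?_
      by_cases hr : r < i
      · rw [ih r hr fun k hk => h k (hk.trans hr.le)]
      · rw [if_neg hr, if_neg hr]
    rw [h2] at h1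
    exact hi i (add_left_cancel h1)

lemma sys_surj (f : ι → ι → W → W) (hf : ∀ i r, i < r → ∀ x, f i r x = 0)
    (hi : ∀ i, Function.Surjective (f i i)) (c : ι → W) :
    ∃ x : ι → W, ∀ i, ∑ r, f i r (x r) = c i := by
  choose g hg using hi
  let ind : ∀ i : ι, (∀ r : ι, r < i → W) → W := fun i ih =>
    g i (c i - ∑ r, if h : r < i then f i r (ih r h) else 0)
  let z : ι → W := WellFoundedLT.fix ind
  have hz : ∀ i, z i = g i (c i - ∑ r, if r < i then f i r (z r) else 0) := by
    intro i
    have := WellFoundedLT.fix_eq ind i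
    simpa only [ind, dite_eq_ite] using this
  refine ⟨z, fun i => ?_⟩
  rw [sys_split f hf]
  conv_lhs => rw [hz i, hg]
  abel

end Tri

section Main

open WittVector Function

variable {p : ℕ} [Fact p.Prime] {A : Type} [CommRing A] {n : ℕ}

lemma Tmap_inj_right (a : WittVector p A) (ha : a.coeff 0 ∈ nonZeroDivisors A) :
    Injective (Tmap a) :=
  tri_inj _ (fun n => a.coeff 0 ^ p ^ n) (fun _ => pow_mem ha _)
    fun x y n h => Tmap_diff_right a x y n h

lemma Tmap_inj_left (x : WittVector p A) (hx : x.coeff 0 ∈ nonZeroDivisors A) :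
    Injective (fun a => Tmap a x) :=
  tri_inj _ (fun _ => x.coeff 0) (fun _ => hx)
    fun a b n h => Tmap_diff_left a b x n h

lemma Tmap_surj_right (a : WittVector p A) (ha : IsUnit (a.coeff 0)) :
    Surjective (Tmap a) :=
  tri_surj _ (fun n => a.coeff 0 ^ p ^ n) (fun _ => ha.pow _)
    fun x y n h => Tmap_diff_right a x y n h

lemma Tmap_surj_left (x : WittVector p A) (hx : IsUnit (x.coeff 0)) :
    Surjective (fun a => Tmap a x) :=
  tri_surj _ (fun _ => x.coeff 0) (fun _ => hx)
    fun a b n h => Tmap_diff_left a b x n h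

abbrev Mat (p n : ℕ) (A : Type) := Matrix (Fin n) (Fin n) (WittVector p A)

lemma star_lower (M N : Mat p n A) (hM : ∀ i j, j < i → M i j = 0)
    (hN : ∀ i j, j < i → N i j = 0) (i j : Fin n) (h : j < i) : starT M N i j = 0 := by
  refine Finset.sum_eq_zero fun r _ => ?_
  rcases lt_or_ge r i with hr | hr
  · rw [hM i r hr, Tmap_zero_left]
  · rw [hN r j (lt_of_lt_of_le h hr), Tmap_zero_right]

lemma star_diag (M N : Mat p n A) (hM : ∀ i j, j < i → M i j = 0)
    (hN : ∀ i j, j < i → N i j = 0) (i : Fin n) :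
    (starT M N i i).coeff 0 = (M i i).coeff 0 * (N i i).coeff 0 := by
  have : starT M N i i = Tmap (M i i) (N i i) := by
    refine Finset.sum_eq_single i (fun r _ hr => ?_) (by simp)
    rcases lt_or_gt_of_ne hr with hr | hr
    · rw [hM i r hr, Tmap_zero_left]
    · rw [hN r i hr, Tmap_zero_right]
  rw [this, Tmap_coeff_zero]

lemma right_cancel (M M' N : Mat p n A) (hN : IsH N) (i j : Fin n)
    (h : ∀ k ≤ j, starT M N i k = starT M' N i k) : M i j = M' i j :=
  sys_inj (ι := Fin n) (fun k r x => Tmap x (N r k))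
    (fun k r hkr x => by rw [hN.1 r k hkr, Tmap_zero_right])
    (fun k => Tmap_inj_left _ (hN.2 k)) (M i) (M' i) j h

lemma left_cancel (M N N' : Mat p n A) (hM : IsH M) (i j : Fin n)
    (h : ∀ k ≥ i, starT M N k j = starT M N' k j) : N i j = N' i j :=
  sys_inj (ι := (Fin n)ᵒᵈ) (fun k r x => Tmap (M k r) x)
    (fun k r hkr x => by rw [hM.1 k r hkr, Tmap_zero_left])
    (fun k => Tmap_inj_right _ (hM.2 k)) (fun r => N r j) (fun r => N' r j) i h

lemma starT_zero_left (N : Mat p n A) (i j : Fin n) : starT 0 N i j = 0 :=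
  Finset.sum_eq_zero fun _ _ => Tmap_zero_left _

lemma starT_zero_right (N : Mat p n A) (i j : Fin n) : starT N 0 i j = 0 :=
  Finset.sum_eq_zero fun _ _ => Tmap_zero_right _

lemma starT_one_left (M : Mat p n A) : starT 1 M = M := by
  ext1 i j
  refine (Finset.sum_eq_single i (fun r _ hr => ?_) (by simp)).trans ?_
  · rw [Matrix.one_apply_ne hr.symm, Tmap_zero_left]
  · rw [Matrix.one_apply_eq, Tmap_one_left]

lemma starT_one_right (M : Mat p n A) : starT M 1 = M := by
  ext1 i j
  refine (Finset.sum_eq_single j (fun r _ hr => ?_) (by simp)).trans ?_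
  · rw [Matrix.one_apply_ne hr, Tmap_zero_right]
  · rw [Matrix.one_apply_eq, Tmap_one_right]

lemma exists_right {K : Type} [Field K] (M C : Mat p n K) (hM : IsH M) (hC : IsH C) :
    ∃ N, IsH N ∧ starT M N = C := by
  have hs : ∀ j : Fin n, ∃ x : Fin n → WittVector p K,
      ∀ i, ∑ r, Tmap (M i r) (x r) = C i j := fun j =>
    sys_surj (ι := (Fin n)ᵒᵈ) (fun k r x => Tmap (M k r) x)
      (fun k r hkr x => by rw [hM.1 k r hkr, Tmap_zero_left])
      (fun k => Tmap_surj_right _ (nonZeroDivisors.ne_zero (hM.2 k)).isUnit) (fun i => C i j)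
  choose x hx using hs
  have hMN : starT M (fun i j => x j i) = C := by
    ext1 i j; exact hx j i
  have hlow : ∀ i j : Fin n, j < i → x j i = 0 := by
    intro i j hij
    refine left_cancel M (fun i j => x j i) 0 hM i j fun k hk => ?_
    rw [hMN, starT_zero_right, hC.1 k j (lt_of_lt_of_le hij hk)]
  refine ⟨fun i j => x j i, ⟨hlow, fun i => ?_⟩, hMN⟩
  have hd := star_diag M (fun i j => x j i) hM.1 hlow i
  have hc := hC.2 i
  rw [← hMN, hd] at hc
  exact (mul_mem_nonZeroDivisors.1 hc).2

lemma exists_left {K : Type} [Field K] (M C : Mat p n K) (hM : IsH M) (hC : IsH C) :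
    ∃ N, IsH N ∧ starT N M = C := by
  have hs : ∀ i : Fin n, ∃ x : Fin n → WittVector p K,
      ∀ j, ∑ r, Tmap (x r) (M r j) = C i j := fun i =>
    sys_surj (ι := Fin n) (fun k r x => Tmap x (M r k))
      (fun k r hkr x => by rw [hM.1 r k hkr, Tmap_zero_right])
      (fun k => Tmap_surj_left _ (nonZeroDivisors.ne_zero (hM.2 k)).isUnit) (C i)
  choose x hx using hs
  have hMN : starT x M = C := by
    ext1 i j; exact hx i j
  have hlow : ∀ i j : Fin n, j < i → x i j = 0 := by
    intro i j hij
    refine right_cancel x 0 M hM i j fun k hk => ?_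
    rw [hMN, starT_zero_left, hC.1 i k (lt_of_le_of_lt hk hij)]
  refine ⟨x, ⟨hlow, fun i => ?_⟩, hMN⟩
  have hd := star_diag x M hlow hM.1 i
  have hc := hC.2 i
  rw [← hMN, hd] at hc
  exact (mul_mem_nonZeroDivisors.1 hc).1

end Main

/-- `ℋ_n(W(A))` is closed under `⋆_T` and the cancellation laws hold;
if `A` is a field then `(ℋ_n(W(A)), ⋆_T, 1)` is a loop. -/
theorem statement_17 (p : ℕ) [Fact p.Prime] (A : Type) [CommRing A] (n : ℕ) :
    (∀ M N : Matrix (Fin n) (Fin n) (WittVector p A), IsH M → IsH N → IsH (starT M N)) ∧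
    (∀ M M' N : Matrix (Fin n) (Fin n) (WittVector p A), IsH M → IsH M' → IsH N →
      starT M N = starT M' N → M = M') ∧
    (∀ M N N' : Matrix (Fin n) (Fin n) (WittVector p A), IsH M → IsH N → IsH N' →
      starT M N = starT M N' → N = N') ∧
    (∀ (K : Type) [Field K],
      IsH (1 : Matrix (Fin n) (Fin n) (WittVector p K)) ∧
      (∀ M : Matrix (Fin n) (Fin n) (WittVector p K), IsH M →
        starT 1 M = M ∧ starT M 1 = M) ∧
      (∀ M C : Matrix (Fin n) (Fin n) (WittVector p K), IsH M → IsH C →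
        (∃! N, IsH N ∧ starT M N = C) ∧ (∃! N, IsH N ∧ starT N M = C))) := by
  refine ⟨fun M N hM hN => ⟨star_lower M N hM.1 hN.1, fun i => ?_⟩, fun M M' N _ _ hN h => ?_,
    fun M N N' hM _ _ h => ?_, fun K _ => ⟨⟨fun i j h => Matrix.one_apply_ne h.ne', fun i => ?_⟩,
      fun M _ => ⟨starT_one_left M, starT_one_right M⟩, fun M C hM hC => ⟨?_, ?_⟩⟩⟩
  · rw [star_diag M N hM.1 hN.1]
    exact mul_mem (hM.2 i) (hN.2 i)
  · ext1 i j
    exact right_cancel M M' N hN i j fun k _ => by rw [h]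
  · ext1 i j
    exact left_cancel M N N' hM i j fun k _ => by rw [h]
  · rw [Matrix.one_apply_eq, WittVector.one_coeff_zero]
    exact one_mem _
  · obtain ⟨N, hN, h⟩ := exists_right M C hM hC
    refine ⟨N, ⟨hN, h⟩, fun N' hN' => ?_⟩
    ext1 i j
    exact left_cancel M N' N hM i j fun k _ => by rw [h, hN'.2]
  · obtain ⟨N, hN, h⟩ := exists_left M C hM hC
    refine ⟨N, ⟨hN, h⟩, fun N' hN' => ?_⟩
    ext1 i j
    exact right_cancel N' N M hM i j fun k _ => by rw [h, hN'.2]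

end MRT
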